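/- Let D_1,…,D_q be hypersurfaces in N-subgeneral position in a smooth projective variety V ⊂ ℂP^M of dimension n, with Nochka weights ω(1),…,ω(q), where N ≥ n and q ≥ 2N−n+1. Let R ⊆ Q = {1,…,q} with 0 < #R ≤ N+1, set c* = c(R), and let E_1,…,E_q be arbitrary nonnegative real constants. Then there exist indices j_1,…,j_{c*} ∈ R such that the hypersurfaces D_{j_1},…,D_{j_{c*}} are in general position in V and Σ_{j∈R} ω(j)·E_j ≤ Σ_{i=1}^{c*} E_{j_i}. -/

import Mathlib

open MvPolynomial Filter

noncomputable section

namespace SMT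

/-- The affine cone in `ℂ^K` cut out by an ideal of polynomials
(the common zero set of all its members). -/
def coneOf {K : ℕ} (I : Ideal (MvPolynomial (Fin K) ℂ)) : Set (Fin K → ℂ) :=
  {x | ∀ Q ∈ I, MvPolynomial.eval x Q = 0}

/-- The vanishing ideal of a subset of `ℂ^K`. -/
def vIdeal {K : ℕ} (A : Set (Fin K → ℂ)) : Ideal (MvPolynomial (Fin K) ℂ) where
  carrier := {Q | ∀ x ∈ A, MvPolynomial.eval x Q = 0}
  add_mem' := by
    intro a b ha hb x hx
    simp [ha x hx, hb x hx]
  zero_mem' := by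
    intro x hx
    simp
  smul_mem' := by
    intro c p hp x hx
    simp [smul_eq_mul, hp x hx]

/-- The dimension of (the affine cone over) a subset of `ℂ^K`:
the Krull dimension of its coordinate ring, read off as a natural number. -/
def coneDim {K : ℕ} (A : Set (Fin K → ℂ)) : ℕ :=
  ENat.toNat ((ringKrullDim (MvPolynomial (Fin K) ℂ ⧸ vIdeal A)).unbotD 0)

/-- `I` is the homogeneous (prime) ideal of a complex projective variety of dimension `n`
in `ℂP^{K-1}`: it is prime, generated by homogeneous polynomials, and the affine cone
has Krull dimension `n + 1`. -/
def IsVariety {K : ℕ} (n : ℕ) (I : Ideal (MvPolynomial (Fin K) ℂ)) : Prop :=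
  I.IsPrime ∧
  (∃ S : Set (MvPolynomial (Fin K) ℂ), (∀ Q ∈ S, ∃ e, Q.IsHomogeneous e) ∧ I = Ideal.span S) ∧
  ringKrullDim (MvPolynomial (Fin K) ℂ ⧸ I) = (((n + 1 : ℕ) : ℕ∞) : WithBot ℕ∞)

/-- A smooth complex projective variety of dimension `n` in `ℂP^{K-1}`, presented by its
homogeneous prime ideal: smoothness via the Jacobian criterion at every nonzero point of
the affine cone. -/
def IsSmoothVariety {K : ℕ} (n : ℕ) (I : Ideal (MvPolynomial (Fin K) ℂ)) : Prop :=
  IsVariety n I ∧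
  ∀ x ∈ coneOf I, x ≠ 0 →
    Module.finrank ℂ (Submodule.span ℂ
      {v : Fin K → ℂ | ∃ Q ∈ I, v = fun i => MvPolynomial.eval x (MvPolynomial.pderiv i Q)})
      = K - 1 - n

/-- The affine cone over the hypersurface defined by a homogeneous polynomial. -/
def hypCone {K : ℕ} (Q : MvPolynomial (Fin K) ℂ) : Set (Fin K → ℂ) :=
  {x | MvPolynomial.eval x Q = 0}

/-- The affine cone over `V ∩ (∩_{j ∈ R} D_j)`. -/
def interCone {K q : ℕ} (I : Ideal (MvPolynomial (Fin K) ℂ))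
    (Q : Fin q → MvPolynomial (Fin K) ℂ) (R : Finset (Fin q)) : Set (Fin K → ℂ) :=
  coneOf I ∩ ⋂ j ∈ R, hypCone (Q j)

/-- The codimension function `c(R) = codim_V (V ∩ ∩_{j∈R} D_j)`, with `c(∅) = 0` and
the convention `codim ∅ = n+1` (the cone over the empty projective set is `{0}`,
of cone dimension `0`). -/
def cdim {K q : ℕ} (n : ℕ) (I : Ideal (MvPolynomial (Fin K) ℂ))
    (Q : Fin q → MvPolynomial (Fin K) ℂ) (R : Finset (Fin q)) : ℕ :=
  n + 1 - coneDim (interCone I Q R)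

/-- `ρ(R₁,R₂) = (c(R₂) - c(R₁)) / (#R₂ - #R₁)`. -/
def rho {K q : ℕ} (n : ℕ) (I : Ideal (MvPolynomial (Fin K) ℂ))
    (Q : Fin q → MvPolynomial (Fin K) ℂ) (R₁ R₂ : Finset (Fin q)) : ℝ :=
  ((cdim n I Q R₂ : ℝ) - (cdim n I Q R₁ : ℝ)) / ((R₂.card : ℝ) - (R₁.card : ℝ))

/-- The hypersurfaces `D_j = {Q j = 0}`, `j ∈ S`, are in general position in the
projective variety `V` (of dimension `n`) defined by `I`: any `s` of them (`1 ≤ s ≤ n+1`)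
can be complemented by `n+1-s` further hypersurfaces so that the total intersection with
`V` is empty (in projective space, i.e. the cones meet only in `0`). -/
def GenPos {K q : ℕ} (n : ℕ) (I : Ideal (MvPolynomial (Fin K) ℂ))
    (Q : Fin q → MvPolynomial (Fin K) ℂ) (S : Finset (Fin q)) : Prop :=
  ∀ J : Finset (Fin q), J ⊆ S → 1 ≤ J.card → J.card ≤ n + 1 →
    ∃ Q' : Fin (n + 1 - J.card) → MvPolynomial (Fin K) ℂ,
      (∀ k, ∃ e, 1 ≤ e ∧ (Q' k).IsHomogeneous e) ∧
      ∀ x ∈ interCone I Q J, (∀ k, MvPolynomial.eval x (Q' k) = 0) → x = 0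

/-- A set is algebraic if it is the zero set of its vanishing ideal. -/
def IsAlgSet {K : ℕ} (A : Set (Fin K → ℂ)) : Prop := A = coneOf (vIdeal A)

/-- `σ` is an irreducible component of `S`: an algebraic irreducible subset of `S`,
maximal among such. -/
def IsIrredComponent {K : ℕ} (σ S : Set (Fin K → ℂ)) : Prop :=
  σ ⊆ S ∧ IsAlgSet σ ∧ (vIdeal σ).IsPrime ∧
  ∀ τ : Set (Fin K → ℂ), τ ⊆ S → IsAlgSet τ → (vIdeal τ).IsPrime → σ ⊆ τ → σ = τ

/-- Condition (i) of Definition 1.1: any `N+1` of the hypersurfaces meet `V` in the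
empty (projective) set. -/
def SubgenI {K q : ℕ} (N : ℕ) (I : Ideal (MvPolynomial (Fin K) ℂ))
    (Q : Fin q → MvPolynomial (Fin K) ℂ) : Prop :=
  ∀ J : Finset (Fin q), J.card = N + 1 → ∀ x ∈ interCone I Q J, x = 0

/-- Condition (ii) of Definition 1.1. -/
def SubgenII {K q : ℕ} (n : ℕ) (I : Ideal (MvPolynomial (Fin K) ℂ))
    (Q : Fin q → MvPolynomial (Fin K) ℂ) : Prop :=
  ∀ J : Finset (Fin q), 0 < J.card → J.card ≤ n + 1 → GenPos n I Q J →
    (∃ x ∈ interCone I Q J, x ≠ 0) →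
    ∃ σ : Set (Fin K → ℂ), IsIrredComponent σ (interCone I Q J) ∧
      coneDim σ = coneDim (interCone I Q J) ∧
      ∀ i ∉ J, coneDim (interCone I Q (insert i J)) = coneDim (interCone I Q J) →
        σ ⊆ hypCone (Q i)

/-- The hypersurfaces `D_j = {Q j = 0}` are in `N`-subgeneral position in the projective
variety `V` defined by `I` (Definition 1.1), including the requirement `V ⊄ D_j`. -/
def InSubgenPos {K q : ℕ} (n N : ℕ) (I : Ideal (MvPolynomial (Fin K) ℂ))
    (Q : Fin q → MvPolynomial (Fin K) ℂ) : Prop :=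
  (∀ j, ¬ (coneOf I ⊆ hypCone (Q j))) ∧ SubgenI N I Q ∧ SubgenII n I Q

/-- The Hilbert function `H_X(m) = dim_ℂ ℂ[x]_m / I(m)` of (the variety with homogeneous
ideal) `I`. -/
def hilbert {K : ℕ} (I : Ideal (MvPolynomial (Fin K) ℂ)) (m : ℕ) : ℕ :=
  Module.finrank ℂ
    ((MvPolynomial.homogeneousSubmodule (Fin K) ℂ m) ⧸
      (Submodule.comap (MvPolynomial.homogeneousSubmodule (Fin K) ℂ m).subtype
        (Submodule.restrictScalars ℂ I)))

/-- The degree of an `n`-dimensional projective variety with homogeneous ideal `I`: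
the (unique) natural number `Δ` with `H(m) = Δ·mⁿ/n! + O(m^{n-1})`. -/
def pdeg {K : ℕ} (n : ℕ) (I : Ideal (MvPolynomial (Fin K) ℂ)) : ℕ :=
  sInf {Δ : ℕ | Filter.Tendsto
    (fun m : ℕ => (hilbert I m : ℝ) * (n.factorial : ℝ) / (m : ℝ) ^ n)
    Filter.atTop (nhds (Δ : ℝ))}

/-- The image cone of the cone of `I` under `x ↦ (Q_1(x), …, Q_q(x))`. -/
def imgCone {K q : ℕ} (I : Ideal (MvPolynomial (Fin K) ℂ))
    (Q : Fin q → MvPolynomial (Fin K) ℂ) : Set (Fin q → ℂ) :=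
  (fun x j => MvPolynomial.eval x (Q j)) '' coneOf I

/-! Nevanlinna-theoretic notions. -/

/-- `‖f(z)‖ = max_i |f_i(z)|` for a tuple of functions. -/
def projNorm {ι : Type*} [Fintype ι] (f : ι → ℂ → ℂ) (z : ℂ) : ℝ :=
  ⨆ i, ‖f i z‖

/-- The Nevanlinna characteristic function
`T_f(r) = (2π)⁻¹ ∫_0^{2π} log ‖f(re^{iθ})‖ dθ`. -/
def charFn {ι : Type*} [Fintype ι] (f : ι → ℂ → ℂ) (r : ℝ) : ℝ :=
  (2 * Real.pi)⁻¹ *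
    ∫ θ in (0:ℝ)..(2 * Real.pi),
      Real.log (projNorm f ((r : ℂ) * Complex.exp ((θ : ℂ) * Complex.I)))

/-- The vanishing order of an entire function at a point (the zero divisor). -/
def zeroOrder (φ : ℂ → ℂ) (z : ℂ) : ℕ :=
  sInf {k : ℕ | iteratedDeriv k φ z ≠ 0}

/-- The (unintegrated) counting function `N_φ(r)` of the zero divisor of `φ`. -/
def count (φ : ℂ → ℂ) (r : ℝ) : ℝ :=
  ∫ t in (1:ℝ)..r, (∑ᶠ z ∈ {z : ℂ | ‖z‖ < t}, ((zeroOrder φ z : ℕ) : ℝ)) / t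

/-- The counting function truncated at level `L`. -/
def countTrunc (L : ℕ) (φ : ℂ → ℂ) (r : ℝ) : ℝ :=
  ∫ t in (1:ℝ)..r,
    (∑ᶠ z ∈ {z : ℂ | ‖z‖ < t}, ((min (zeroOrder φ z) L : ℕ) : ℝ)) / t

/-- A tuple of entire functions without common zeros (a reduced representation of a
holomorphic curve in projective space). -/
def ReducedRepr {ι : Type*} [Fintype ι] (f : ι → ℂ → ℂ) : Prop :=
  (∀ i, Differentiable ℂ (f i)) ∧ ∀ z, ∃ i, f i z ≠ 0

/-- The entire function `Q(f_0, …, f_{K-1})`. -/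
def polyComp {K : ℕ} (Q : MvPolynomial (Fin K) ℂ) (f : Fin K → ℂ → ℂ) : ℂ → ℂ :=
  fun z => MvPolynomial.eval (fun i => f i z) Q

/-- The curve with reduced representation `f` has image inside the variety of `I`. -/
def MapsIntoCone {K : ℕ} (f : Fin K → ℂ → ℂ) (I : Ideal (MvPolynomial (Fin K) ℂ)) : Prop :=
  ∀ z, (fun i => f i z) ∈ coneOf I

/-- `f` is an algebraically nondegenerate holomorphic map into the variety of `I`:
its image is contained in `V` but in no proper algebraic subvariety of `V`. -/
def AlgNondeg {K : ℕ} (f : Fin K → ℂ → ℂ) (I : Ideal (MvPolynomial (Fin K) ℂ)) : Prop :=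
  MapsIntoCone f I ∧
  ∀ P : MvPolynomial (Fin K) ℂ, (∃ e, P.IsHomogeneous e) → P ∉ I →
    ∃ z, polyComp P f z ≠ 0

/-- `P r` holds for all `r ∈ [1,∞)` outside a Borel subset `E` of `(1,∞)` of finite
Lebesgue measure. -/
def ExcSMT (P : ℝ → Prop) : Prop :=
  ∃ E : Set ℝ, MeasurableSet E ∧ E ⊆ Set.Ioi 1 ∧ MeasureTheory.volume E < ⊤ ∧
    ∀ r : ℝ, 1 ≤ r → r ∉ E → P r

theorem dim_cut {R : Type*} [CommRing R] (I J : Ideal R) (hIJ : I ≤ J) (r : R) (hr : r ∈ J)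
    (h : ∀ p ∈ I.minimalPrimes, r ∉ p ∨ p.IsMaximal) (d : ℕ)
    (hd : ringKrullDim (R ⧸ I) ≤ ((d + 1 : ℕ) : WithBot ℕ∞)) :
    ringKrullDim (R ⧸ J) ≤ (d : WithBot ℕ∞) := by
  rw [ringKrullDim_quotient] at hd ⊢
  refine iSup_le fun l => ?_
  have hl : I ≤ l.head.1.asIdeal := hIJ.trans l.head.2
  have := l.head.1.2
  obtain ⟨p, hp, hp'⟩ := Ideal.exists_minimalPrimes_le hl
  rcases h p hp with h1 | h1
  · let p' : PrimeSpectrum.zeroLocus (R := R) I := ⟨⟨p, hp.1.1⟩, hp.1.2⟩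
    let g : PrimeSpectrum.zeroLocus (R := R) J → PrimeSpectrum.zeroLocus (R := R) I :=
      fun x => ⟨x.1, fun y hy => x.2 (hIJ hy)⟩
    let l' := l.map g (fun _ _ h => h)
    have hlt : p' < l'.head := by
      refine lt_of_le_of_ne hp' fun h => h1 ?_
      have h2 : p = l.head.1.asIdeal := congrArg (fun x => x.1.asIdeal) h
      rw [h2]; exact l.head.2 hr
    have := (le_iSup (fun l : LTSeries _ => (l.length : WithBot ℕ∞)) (l'.cons p' hlt)).trans hd
    have h3 : (l'.cons p' hlt).length = l.length + 1 := by
      rw [RelSeries.cons_length]; rfl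
    rw [h3] at this
    have h4 : l.length + 1 ≤ d + 1 := by exact_mod_cast this
    have h5 : l.length ≤ d := by omega
    exact_mod_cast h5
  · have h0 : l.length = 0 := by
      by_contra hne
      have hlt : l.head < l.last := by
        apply l.strictMono
        rw [Fin.lt_def]; simp; omega
      have h2 : p < l.last.1.asIdeal := lt_of_le_of_lt hp' hlt
      exact l.last.1.2.ne_top (h1.1.2 _ h2)
    rw [h0]
    exact_mod_cast Nat.zero_le d

theorem maximal_of_X {K : ℕ} (p : Ideal (MvPolynomial (Fin K) ℂ)) (hp : p ≠ ⊤)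
    (h : ∀ i, (X i : MvPolynomial (Fin K) ℂ) ∈ p) : p.IsMaximal := by
  have key : ∀ q : MvPolynomial (Fin K) ℂ, q - C (constantCoeff q) ∈ p := by
    intro q
    induction q using MvPolynomial.induction_on with
    | C a => simp
    | add a b ha hb =>
      have := p.add_mem ha hb
      convert this using 1
      simp; ring
    | mul_X a i ha =>
      simp only [map_mul, constantCoeff_X, mul_zero, map_zero, sub_zero]
      exact p.mul_mem_left _ (h i)
  refine ⟨⟨hp, fun J hJ => ?_⟩⟩
  obtain ⟨q, hqJ, hqp⟩ := SetLike.exists_of_lt hJ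
  have hc : constantCoeff q ≠ 0 := by
    intro h0
    apply hqp
    have := key q
    simpa [h0] using this
  have hC : C (constantCoeff q) ∈ J := by
    have := J.sub_mem hqJ (hJ.le (key q))
    simpa using this
  exact Ideal.eq_top_of_isUnit_mem _ hC ((isUnit_iff_ne_zero.mpr hc).map C)

theorem coneOf_span {K : ℕ} (S : Set (MvPolynomial (Fin K) ℂ)) :
    coneOf (Ideal.span S) = {x | ∀ Q ∈ S, eval x Q = 0} := by
  ext x
  constructor
  · intro h Q hQ; exact h Q (Ideal.subset_span hQ)
  · intro h Q hQ
    have : Ideal.span S ≤ RingHom.ker (eval x) := Ideal.span_le.mpr h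
    exact this hQ

theorem dim_pos {K : ℕ} (S : Set (MvPolynomial (Fin K) ℂ))
    (hS : ∀ Q ∈ S, ∃ e, Q.IsHomogeneous e) (x : Fin K → ℂ) (hx : x ∈ coneOf (Ideal.span S))
    (hx0 : x ≠ 0) : 1 ≤ ringKrullDim (MvPolynomial (Fin K) ℂ ⧸ Ideal.span S) := by
  let φ : MvPolynomial (Fin K) ℂ →ₐ[ℂ] Polynomial ℂ :=
    aeval (fun i => Polynomial.C (x i) * Polynomial.X)
  have hφ : ∀ Q ∈ Ideal.span S, φ Q = 0 := by
    have : Ideal.span S ≤ RingHom.ker φ := by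
      refine Ideal.span_le.mpr fun Q hQ => ?_
      obtain ⟨e, he⟩ := hS Q hQ
      have h0 : eval x Q = 0 := hx Q (Ideal.subset_span hQ)
      have hsum : φ Q = Polynomial.C (eval x Q) * Polynomial.X ^ e := by
        simp only [φ, aeval_def, eval₂_eq', eval_eq', map_sum, Finset.sum_mul]
        refine Finset.sum_congr rfl fun a ha => ?_
        have hdeg : ∑ i, a i = e := by
          have := he (mem_support_iff.mp ha)
          rw [Finsupp.weight_apply, Finsupp.sum_fintype] at this <;> simp_all
        simp only [mul_pow, Finset.prod_mul_distrib, Finset.prod_pow_eq_pow_sum, hdeg,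
          Polynomial.algebraMap_eq, map_mul, map_prod, map_pow, mul_assoc]
      simp [RingHom.mem_ker, hsum, h0]
    exact fun Q hQ => this hQ
  obtain ⟨i, hi⟩ : ∃ i, x i ≠ 0 := by
    by_contra! h; exact hx0 (funext h)
  have hsurj : Function.Surjective φ := by
    have hX : Polynomial.X ∈ φ.range := by
      refine ⟨C (x i)⁻¹ * X i, ?_⟩
      simp [φ, ← mul_assoc, ← Polynomial.C_mul, inv_mul_cancel₀ hi]
    intro p
    have : p ∈ Algebra.adjoin ℂ {(Polynomial.X : Polynomial ℂ)} := by
      rw [Polynomial.adjoin_X]; trivial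
    exact Algebra.adjoin_le (S := φ.range) (by simpa using hX) this
  have h1 := ringKrullDim_le_of_surjective (Ideal.Quotient.lift (Ideal.span S) φ.toRingHom hφ)
    (Ideal.Quotient.lift_surjective_of_surjective _ _ hsurj)
  refine le_trans ?_ h1
  rw [Polynomial.ringKrullDim_of_isNoetherianRing]
  simp [ringKrullDim_eq_zero_of_field]

theorem exists_cut {K : ℕ} (d : ℕ) : ∀ (S : Set (MvPolynomial (Fin K) ℂ))
    (_ : ∀ Q ∈ S, ∃ e, Q.IsHomogeneous e)
    (_ : ringKrullDim (MvPolynomial (Fin K) ℂ ⧸ Ideal.span S) ≤ (d : WithBot ℕ∞)),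
    ∃ f : Fin d → MvPolynomial (Fin K) ℂ, (∀ k, ∃ e, 1 ≤ e ∧ (f k).IsHomogeneous e) ∧
      ∀ x ∈ coneOf (Ideal.span S), (∀ k, eval x (f k) = 0) → x = 0 := by
  induction d with
  | zero =>
    intro S hS hd
    refine ⟨fun _ => 0, fun k => k.elim0, fun x hx _ => ?_⟩
    by_contra hx0
    have := (dim_pos S hS x hx hx0).trans hd
    have h : (1 : ℕ) ≤ 0 := by exact_mod_cast this
    omega
  | succ d ih =>
    intro S hS hd
    classical
    let L : (Fin K → ℂ) →ₗ[ℂ] MvPolynomial (Fin K) ℂ :=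
      ∑ i, (LinearMap.proj i : (Fin K → ℂ) →ₗ[ℂ] ℂ).smulRight (X i)
    have hL : ∀ a, L a = ∑ i, a i • (X i : MvPolynomial (Fin K) ℂ) := by
      intro a; simp [L]
    let W : Ideal (MvPolynomial (Fin K) ℂ) → Subspace ℂ (Fin K → ℂ) :=
      fun p => (p.restrictScalars ℂ).comap L
    have hfin := (Ideal.span S).finite_minimalPrimes_of_isNoetherianRing
    let s : Finset (Subspace ℂ (Fin K → ℂ)) := (hfin.toFinset.image W).erase ⊤
    have hs : ⊤ ∉ s := by simp [s]
    obtain ⟨a, ha⟩ := (Set.ne_univ_iff_exists_notMem _).mp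
      (Subspace.biUnion_ne_univ_of_top_notMem hs)
    have hLhom : (L a).IsHomogeneous 1 := by
      rw [hL]
      refine IsHomogeneous.sum _ _ _ fun i _ => ?_
      rw [smul_eq_C_mul]
      simpa using (isHomogeneous_C (Fin K) (a i)).mul (isHomogeneous_X ℂ i)
    have hS' : ∀ Q ∈ insert (L a) S, ∃ e, Q.IsHomogeneous e := by
      rintro Q (rfl | hQ)
      · exact ⟨1, hLhom⟩
      · exact hS Q hQ
    obtain ⟨f, hf1, hf2⟩ := ih (insert (L a) S) hS' (by
      refine dim_cut (Ideal.span S) _ (Ideal.span_mono (Set.subset_insert _ _)) (L a)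
        (Ideal.subset_span (Set.mem_insert _ _)) ?_ d hd
      intro p hp
      by_cases hW : W p = ⊤
      · right
        refine maximal_of_X p hp.1.1.ne_top fun i => ?_
        have : Pi.single i (1 : ℂ) ∈ W p := by rw [hW]; trivial
        have h2 : L (Pi.single i 1) ∈ p := this
        rw [hL] at h2
        simpa [Pi.single_apply] using h2
      · left
        intro hmem
        apply ha
        simp only [Set.mem_iUnion]
        refine ⟨W p, ?_, hmem⟩
        simp only [s, Finset.mem_erase, Finset.mem_image, Set.Finite.mem_toFinset]
        exact ⟨hW, p, hp, rfl⟩)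
    refine ⟨Fin.cons (L a) f, ?_, ?_⟩
    · intro k
      refine Fin.cases ?_ (fun k => ?_) k
      · exact ⟨1, le_rfl, by simpa using hLhom⟩
      · simpa using hf1 k
    · intro x hx hk
      refine hf2 x ?_ (fun k => by simpa using hk k.succ)
      rw [coneOf_span] at hx ⊢
      rintro Q (rfl | hQ)
      · simpa using hk 0
      · exact hx Q hQ

theorem vIdeal_coneOf {K : ℕ} (J : Ideal (MvPolynomial (Fin K) ℂ)) :
    vIdeal (coneOf J) = J.radical := by
  rw [← vanishingIdeal_zeroLocus_eq_radical (K := ℂ)]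
  ext p
  simp [vIdeal, coneOf, mem_vanishingIdeal_iff, zeroLocus, aeval_eq_eval]

theorem comp_mul_le {K : ℕ} {a b : MvPolynomial (Fin K) ℂ} {e d : ℕ} (hb : b.IsHomogeneous e)
    (h : e ≤ d) :
    homogeneousComponent d (a * b) = homogeneousComponent (d - e) a * b := by
  let := MvPolynomial.gradedAlgebra (σ := Fin K) (R := ℂ)
  have := DirectSum.coe_decompose_mul_of_right_mem_of_le
    (homogeneousSubmodule (Fin K) ℂ) (a := a) (n := d) (i := e) (b := b) hb h
  rw [← decomposition.decompose'_apply (a * b) d, ← decomposition.decompose'_apply a (d - e)]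
  exact this

theorem comp_mul_not_le {K : ℕ} {a b : MvPolynomial (Fin K) ℂ} {e d : ℕ} (hb : b.IsHomogeneous e)
    (h : ¬ e ≤ d) :
    homogeneousComponent d (a * b) = 0 := by
  let := MvPolynomial.gradedAlgebra (σ := Fin K) (R := ℂ)
  have := DirectSum.coe_decompose_mul_of_right_mem_of_not_le
    (homogeneousSubmodule (Fin K) ℂ) (a := a) (n := d) (i := e) (b := b) hb h
  rw [← decomposition.decompose'_apply (a * b) d]; exact this

theorem dim_le_of_integral {A B : Type*} [CommRing A] [CommRing B] [Algebra A B]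
    [Algebra.IsIntegral A B] : ringKrullDim B ≤ ringKrullDim A := by
  refine Order.krullDim_le_of_strictMono (PrimeSpectrum.comap (algebraMap A B)) ?_
  intro p q hpq
  exact Ideal.IsIntegral.comap_lt_comap (show p.asIdeal < q.asIdeal from hpq)

theorem dim_le_of_cut_aux {K : ℕ} {A : Type} [CommRing A] [Algebra ℂ A]
    (mk : MvPolynomial (Fin K) ℂ →ₐ[ℂ] A) (hmk : Function.Surjective mk) (S : Set (MvPolynomial (Fin K) ℂ))
    (hS : ∀ Q ∈ S, ∃ e, Q.IsHomogeneous e) {ι : Type} [Fintype ι]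
    (f : ι → MvPolynomial (Fin K) ℂ) (hf : ∀ k, ∃ e, 1 ≤ e ∧ (f k).IsHomogeneous e)
    (hmk0 : ∀ x ∈ S, mk x = 0)
    (hcut : ∀ x ∈ coneOf (Ideal.span S), (∀ k, eval x (f k) = 0) → x = 0) :
    ringKrullDim A ≤ (Fintype.card ι : WithBot ℕ∞) := by
  classical
  let φ : MvPolynomial ι ℂ →ₐ[ℂ] A := aeval (fun k => mk (f k))
  let : Algebra (MvPolynomial ι ℂ) A := φ.toRingHom.toAlgebra
  have hsm : ∀ (c : MvPolynomial ι ℂ) (y : A), c • y = φ c * y := fun c y => rfl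
  let U := S ∪ Set.range f
  have hrad : ∀ i, ∃ m, (X i : MvPolynomial (Fin K) ℂ) ^ m ∈ Ideal.span U := by
    intro i
    change X i ∈ (Ideal.span U).radical
    rw [← vIdeal_coneOf]
    intro x hx
    rw [coneOf_span] at hx
    have : x = 0 := hcut x (by
      rw [coneOf_span]; exact fun Q hQ => hx Q (Or.inl hQ))
      (fun k => hx _ (Or.inr ⟨k, rfl⟩))
    simp [this]
  choose m hm using hrad
  let N := ∑ i, m i
  have hN : ∀ i, (X i : MvPolynomial (Fin K) ℂ) ^ N ∈ Ideal.span U := by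
    intro i
    exact Ideal.pow_mem_of_pow_mem _ (hm i) (Finset.single_le_sum (f := m) (by simp) (Finset.mem_univ i))
  let G : Set A := Set.range (fun a : Fin K → Fin N =>
    mk (monomial (Finsupp.equivFunOnFinite.symm (fun i => (a i : ℕ))) 1))
  let Mo : Submodule (MvPolynomial ι ℂ) A := Submodule.span _ G
  have hspan : ∀ d, (∀ d' < d, ∀ r : MvPolynomial (Fin K) ℂ, r.IsHomogeneous d' → mk r ∈ Mo) →
      ∀ p ∈ Ideal.span U, ∀ a, mk (homogeneousComponent d (a * p)) ∈ Mo := by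
    intro d hd p hp
    induction hp using Submodule.span_induction with
    | mem x hx =>
      intro a
      rcases hx with hx | ⟨k, rfl⟩
      · obtain ⟨e, he⟩ := hS x hx
        by_cases h : e ≤ d
        · rw [comp_mul_le he h, map_mul]
          have : mk x = 0 := hmk0 x hx
          rw [this, mul_zero]; exact Mo.zero_mem
        · rw [comp_mul_not_le he h, map_zero]; exact Mo.zero_mem
      · obtain ⟨e, he1, he⟩ := hf k
        by_cases h : e ≤ d
        · rw [comp_mul_le he h, map_mul]
          have h1 := hd (d - e) (by omega) _ (homogeneousComponent_isHomogeneous (d - e) a)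
          have h2 := Mo.smul_mem (X k) h1
          rw [hsm] at h2
          simpa [φ, mul_comm] using h2
        · rw [comp_mul_not_le he h, map_zero]; exact Mo.zero_mem
    | zero => intro a; simp
    | add x y _ _ hx hy =>
      intro a
      rw [mul_add, map_add, map_add]; exact Mo.add_mem (hx a) (hy a)
    | smul b x _ hx =>
      intro a
      rw [smul_eq_mul, ← mul_assoc]; exact hx _
  have hall : ∀ d, ∀ r : MvPolynomial (Fin K) ℂ, r.IsHomogeneous d → mk r ∈ Mo := by
    intro d
    induction d using Nat.strong_induction_on with
    | _ d ih =>
      intro r hr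
      rw [r.as_sum, map_sum]
      refine Mo.sum_mem fun a ha => ?_
      by_cases hlt : ∀ i, a i < N
      · have h1 : mk (monomial a 1) ∈ Mo :=
          Submodule.subset_span ⟨fun i => ⟨a i, hlt i⟩, by
            have : Finsupp.equivFunOnFinite.symm (fun i => a i) = a := by ext i; simp
            simp only [this]⟩
        have h2 := Mo.smul_mem (C (coeff a r)) h1
        rw [hsm] at h2
        have h3 : (monomial a (coeff a r) : MvPolynomial (Fin K) ℂ) = coeff a r • monomial a 1 := by
          simp [smul_monomial]
        rw [h3, map_smul, Algebra.smul_def]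
        simpa [φ] using h2
      · push Not at hlt
        obtain ⟨i, hi⟩ := hlt
        have h1 : (monomial a (coeff a r) : MvPolynomial (Fin K) ℂ)
            = monomial (a - Finsupp.single i N) (coeff a r) * X i ^ N := by
          rw [X_pow_eq_monomial, monomial_mul, mul_one, tsub_add_cancel_of_le]
          simpa using hi
        have h2 : (monomial a (coeff a r) : MvPolynomial (Fin K) ℂ).IsHomogeneous d := by
          refine isHomogeneous_monomial _ ?_
          have := hr (mem_support_iff.mp ha)
          rw [Finsupp.degree_eq_weight_one]; exact this
        have h3 := hspan d ih _ (hN i) (monomial (a - Finsupp.single i N) (coeff a r))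
        rw [← h1, homogeneousComponent_of_mem (n := d) h2, if_pos rfl] at h3
        exact h3
  have htop : Mo = ⊤ := by
    refine eq_top_iff.mpr fun y _ => ?_
    obtain ⟨r, rfl⟩ := hmk y
    rw [← sum_homogeneousComponent r, map_sum]
    exact Mo.sum_mem fun d _ => hall d _ (homogeneousComponent_isHomogeneous d r)
  have : Module.Finite (MvPolynomial ι ℂ) A :=
    ⟨Submodule.fg_def.mpr ⟨G, Set.finite_range _, htop⟩⟩
  have h := dim_le_of_integral (A := MvPolynomial ι ℂ) (B := A)
  rw [MvPolynomial.ringKrullDim_of_isNoetherianRing, ringKrullDim_eq_zero_of_field, zero_add,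
    Nat.card_eq_fintype_card] at h
  exact h

theorem dim_le_of_cut {K : ℕ} (S : Set (MvPolynomial (Fin K) ℂ))
    (hS : ∀ Q ∈ S, ∃ e, Q.IsHomogeneous e) {ι : Type} [Fintype ι]
    (f : ι → MvPolynomial (Fin K) ℂ) (hf : ∀ k, ∃ e, 1 ≤ e ∧ (f k).IsHomogeneous e)
    (hcut : ∀ x ∈ coneOf (Ideal.span S), (∀ k, eval x (f k) = 0) → x = 0) :
    ringKrullDim (MvPolynomial (Fin K) ℂ ⧸ Ideal.span S) ≤ (Fintype.card ι : WithBot ℕ∞) :=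
  dim_le_of_cut_aux (Ideal.Quotient.mkₐ ℂ (Ideal.span S)) (Ideal.Quotient.mkₐ_surjective _ _)
    S hS f hf (fun _ hx => Ideal.Quotient.eq_zero_iff_mem.mpr (Ideal.subset_span hx)) hcut

theorem coneDim_eq {K : ℕ} (J : Ideal (MvPolynomial (Fin K) ℂ)) (hJ : J ≠ ⊤) :
    ringKrullDim (MvPolynomial (Fin K) ℂ ⧸ J) = ((coneDim (coneOf J) : ℕ) : WithBot ℕ∞) := by
  have h1 : ringKrullDim (MvPolynomial (Fin K) ℂ ⧸ J.radical)
      = ringKrullDim (MvPolynomial (Fin K) ℂ ⧸ J) := by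
    rw [ringKrullDim_quotient, ringKrullDim_quotient, PrimeSpectrum.zeroLocus_radical]
  have h2 : ringKrullDim (MvPolynomial (Fin K) ℂ ⧸ J) ≤ (K : WithBot ℕ∞) := by
    refine (ringKrullDim_quotient_le J).trans ?_
    rw [MvPolynomial.ringKrullDim_of_isNoetherianRing, ringKrullDim_eq_zero_of_field]
    simp
  have : Nontrivial (MvPolynomial (Fin K) ℂ ⧸ J) := Ideal.Quotient.nontrivial_iff.mpr hJ
  have h3 := ringKrullDim_nonneg_of_nontrivial (R := MvPolynomial (Fin K) ℂ ⧸ J)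
  rw [coneDim, vIdeal_coneOf, h1]
  generalize ringKrullDim (MvPolynomial (Fin K) ℂ ⧸ J) = D at h2 h3
  induction D with
  | bot => simp at h3
  | coe D =>
    have h4 : D ≤ (K : ℕ∞) := by exact_mod_cast h2
    have h5 : D ≠ ⊤ := ne_top_of_le_ne_top (ENat.natCast_ne_top K) h4
    simp only [WithBot.unbotD_coe]
    conv_lhs => rw [← ENat.natCast_toNat h5]
    rfl

theorem comb {q n : ℕ} (c : Finset (Fin q) → ℕ)
    (hsub : ∀ T' T, T' ⊆ T → c T' ≤ c T + (T \ T').card)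
    (mono : ∀ T' T, T' ⊆ T → c T ≤ c T')
    (h0 : c ∅ = n + 1) (h1 : ∀ j, c {j} ≤ n)
    (hspan : ∀ T R : Finset (Fin q), T.Nonempty → c T + T.card = n + 1 → T ⊆ R →
      (∀ i ∈ R, i ∉ T → c (insert i T) = c T) → c R = c T)
    (ω E : Fin q → ℝ) (R : Finset (Fin q)) :
    (∀ R' ⊆ R, R'.Nonempty → ∑ j ∈ R', ω j ≤ ((n + 1 - c R' : ℕ) : ℝ)) →
    ∃ T ⊆ R, c T + T.card = n + 1 ∧ c R = c T ∧ (∀ i ∈ R, i ∉ T → c (insert i T) = c T) ∧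
      ∀ s : ℝ, (∀ j ∈ R, s ≤ E j) → ∑ j ∈ R, ω j * (E j - s) ≤ ∑ j ∈ T, (E j - s) := by
  have hlow : ∀ T, n + 1 ≤ c T + T.card := by
    intro T
    have := hsub ∅ T (Finset.empty_subset _)
    simpa [h0] using this
  have hgood : ∀ T' T, T' ⊆ T → c T + T.card = n + 1 → c T' + T'.card = n + 1 := by
    intro T' T hT h
    have h2 := hsub T' T hT
    rw [Finset.card_sdiff_of_subset hT] at h2
    have h3 := Finset.card_le_card hT
    have := hlow T'
    omega
  have hext : ∀ T i, i ∉ T → c T + T.card = n + 1 →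
      (c (insert i T) = c T ↔ ¬ (c (insert i T) + (insert i T).card = n + 1)) := by
    intro T i hi h
    have h2 := hlow (insert i T)
    have h3 := mono T (insert i T) (Finset.subset_insert _ _)
    rw [Finset.card_insert_of_notMem hi] at h2 ⊢
    omega
  induction R using Finset.induction_on_min_value E with
  | empty =>
    intro _
    exact ⟨∅, by simp, by simp [h0], rfl, by simp, by simp⟩
  | insert m R' hm hmin ih =>
    intro hw
    obtain ⟨T', hT'R, hgT', hcT', hmaxT', hineq⟩ := ih fun R'' hR'' =>
      hw R'' (hR''.trans (Finset.subset_insert _ _))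
    have hmT' : m ∉ T' := fun h => hm (hT'R h)
    obtain ⟨T, hT⟩ : ∃ T, T ⊆ insert m R' ∧ c T + T.card = n + 1 ∧
        (∀ i ∈ insert m R', i ∉ T → c (insert i T) = c T) ∧
        (T = T' ∨ T = insert m T') := by
      by_cases hg : c (insert m T') + (insert m T').card = n + 1
      · refine ⟨insert m T', Finset.insert_subset_insert _ hT'R, hg, ?_, Or.inr rfl⟩
        intro i hi hiT
        have hiT' : i ∉ T' := fun h => hiT (Finset.mem_insert_of_mem h)
        have him : i ≠ m := fun h => hiT (h ▸ Finset.mem_insert_self _ _)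
        have hiR' : i ∈ R' := (Finset.mem_insert.mp hi).resolve_left him
        rw [hext _ _ hiT hg]
        intro hbad
        have h2 := hgood (insert i T') (insert i (insert m T'))
          (Finset.insert_subset_insert _ (Finset.subset_insert _ _)) hbad
        exact (hext T' i hiT' hgT').mp (hmaxT' i hiR' hiT') h2
      · refine ⟨T', hT'R.trans (Finset.subset_insert _ _), hgT', ?_, Or.inl rfl⟩
        intro i hi hiT
        rcases Finset.mem_insert.mp hi with rfl | hi
        · exact (hext T' i hiT hgT').mpr hg
        · exact hmaxT' i hi hiT
    obtain ⟨hTR, hgT, hmaxT, hTor⟩ := hT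
    have hTne : T.Nonempty := by
      by_contra hne
      rw [Finset.not_nonempty_iff_eq_empty] at hne
      subst hne
      have := hmaxT m (Finset.mem_insert_self _ _) (by simp)
      have h2 := h1 m
      simp only [insert_empty_eq] at this
      omega
    have hcT : c (insert m R') = c T := hspan T _ hTne hgT hTR hmaxT
    refine ⟨T, hTR, hgT, hcT, hmaxT, ?_⟩
    intro s hs
    have hsm := hs m (Finset.mem_insert_self _ _)
    have e1 := hineq (E m) hmin
    have e2 := hw _ (Finset.Subset.refl _) ⟨m, Finset.mem_insert_self _ _⟩
    have hcard : n + 1 - c (insert m R') = T.card := by omega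
    rw [hcard] at e2
    have e3 : ∑ j ∈ insert m R', ω j * (E j - s)
        = ∑ j ∈ R', ω j * (E j - E m) + (E m - s) * ∑ j ∈ insert m R', ω j := by
      rw [Finset.sum_insert hm, Finset.sum_insert hm, mul_add, Finset.mul_sum]
      have : ∑ j ∈ R', ω j * (E j - s)
          = ∑ j ∈ R', ω j * (E j - E m) + ∑ j ∈ R', (E m - s) * ω j := by
        rw [← Finset.sum_add_distrib]
        exact Finset.sum_congr rfl fun j _ => by ring
      rw [this]; ring
    have e4 : ∑ j ∈ T, (E j - s) = ∑ j ∈ T, (E j - E m) + (E m - s) * T.card := by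
      have : (E m - s) * (T.card : ℝ) = ∑ j ∈ T, (E m - s) := by
        rw [Finset.sum_const, nsmul_eq_mul, mul_comm]
      rw [this, ← Finset.sum_add_distrib]
      exact Finset.sum_congr rfl fun j _ => by ring
    have e5 : ∑ j ∈ T, (E j - E m) = ∑ j ∈ T', (E j - E m) := by
      rcases hTor with rfl | rfl
      · rfl
      · rw [Finset.sum_insert hmT']; simp
    rw [e3, e4, e5]
    have := mul_le_mul_of_nonneg_left e2 (sub_nonneg.mpr hsm)
    linarith

/-- **Theorem 2.7.** Given Nochka weights `ω` for hypersurfaces in `N`-subgeneral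
position, a subset `R` with `0 < #R ≤ N+1`, `c* = c(R)`, and nonnegative reals `E_j`,
there are `c*` indices in `R` whose hypersurfaces are in general position in `V` with
`∑_{j∈R} ω(j)E_j ≤ ∑_{i=1}^{c*} E_{j_i}`. -/
theorem statement13 {M n N q : ℕ} (hn : 1 ≤ n) (hNn : n ≤ N) (hq : 2 * N - n + 1 ≤ q)
    (I : Ideal (MvPolynomial (Fin (M + 1)) ℂ)) (hV : IsSmoothVariety n I)
    (Q : Fin q → MvPolynomial (Fin (M + 1)) ℂ) (d : Fin q → ℕ)
    (hd : ∀ j, 1 ≤ d j) (hQ : ∀ j, (Q j).IsHomogeneous (d j))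
    (hsub : InSubgenPos n N I Q)
    (ω : Fin q → ℝ) (Θ : ℝ)
    (hw1 : ∀ j, 0 < ω j ∧ ω j ≤ Θ) (hw2 : Θ ≤ 1)
    (hw3 : (∑ j, ω j) = Θ * ((q : ℝ) - 2 * N + n - 1) + n + 1)
    (hw4 : ((n : ℝ) + 1) / (2 * (N : ℝ) - (n : ℝ) + 1) ≤ Θ)
    (hw5 : Θ ≤ ((n : ℝ) + 1) / ((N : ℝ) + 1))
    (hw6 : ∀ R : Finset (Fin q), 0 < R.card → R.card ≤ N + 1 →
      (∑ j ∈ R, ω j) ≤ (cdim n I Q R : ℝ))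
    (R : Finset (Fin q)) (hR1 : 0 < R.card) (hR2 : R.card ≤ N + 1)
    (E : Fin q → ℝ) (hE : ∀ j, 0 ≤ E j) :
    ∃ T : Finset (Fin q), T ⊆ R ∧ T.card = cdim n I Q R ∧ GenPos n I Q T ∧
      (∑ j ∈ R, ω j * E j) ≤ ∑ j ∈ T, E j := by
  classical
  obtain ⟨⟨hIp, ⟨S, hS, hIS⟩, hIdim⟩, -⟩ := hV
  obtain ⟨hnot, -, hII⟩ := hsub
  let U : Finset (Fin q) → Set (MvPolynomial (Fin (M + 1)) ℂ) := fun T => S ∪ Q '' (T : Set (Fin q))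
  let c : Finset (Fin q) → ℕ := fun T => coneDim (interCone I Q T)
  have hU : ∀ T, ∀ P ∈ U T, ∃ e, P.IsHomogeneous e := by
    rintro T P (hP | ⟨j, -, rfl⟩)
    · exact hS P hP
    · exact ⟨_, hQ j⟩
  have hcone : ∀ T, interCone I Q T = coneOf (Ideal.span (U T)) := by
    intro T
    rw [interCone, hIS, coneOf_span, coneOf_span]
    ext x
    simp only [U, hypCone, Set.mem_inter_iff, Set.mem_setOf_eq, Set.mem_iInter, Set.mem_union,
      Set.mem_image, Finset.mem_coe]
    constructor
    · rintro ⟨h1, h2⟩ P (hP | ⟨j, hj, rfl⟩)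
      · exact h1 P hP
      · exact h2 j hj
    · intro h
      exact ⟨fun P hP => h P (Or.inl hP), fun j hj => h _ (Or.inr ⟨j, hj, rfl⟩)⟩
  have hzeroI : ∀ P ∈ S, eval 0 P = 0 := by
    intro P hP
    obtain ⟨e, he⟩ := hS P hP
    by_contra hne
    have hc : coeff 0 P ≠ 0 := by
      rwa [← constantCoeff_eq, ← eval_zero'] 
    have he0 : e = 0 := by
      have := he hc
      simpa using this.symm
    subst he0
    have hPC : P = C (coeff 0 P) := by
      rw [← totalDegree_eq_zero_iff_eq_C]
      exact Nat.le_zero.mp he.totalDegree_le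
    have hPI : P ∈ I := hIS ▸ Ideal.subset_span hP
    rw [hPC] at hPI
    exact hIp.ne_top (Ideal.eq_top_of_isUnit_mem _ hPI ((isUnit_iff_ne_zero.mpr hc).map C))
  have hzero : ∀ T, (0 : Fin (M + 1) → ℂ) ∈ coneOf (Ideal.span (U T)) := by
    intro T
    rw [coneOf_span]
    rintro P (hP | ⟨j, -, rfl⟩)
    · exact hzeroI P hP
    · by_contra hne
      have hc : coeff 0 (Q j) ≠ 0 := by
        rwa [← constantCoeff_eq, ← eval_zero']
      have := hQ j hc
      have h2 := hd j
      simp at this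
      omega
  have hproper : ∀ T, Ideal.span (U T) ≠ ⊤ := by
    intro T h
    have := hzero T 1 (by rw [h]; trivial)
    simp at this
  have hdim : ∀ T, ringKrullDim (MvPolynomial (Fin (M + 1)) ℂ ⧸ Ideal.span (U T))
      = (c T : WithBot ℕ∞) := by
    intro T
    rw [coneDim_eq _ (hproper T), ← hcone]
  have hexists : ∀ T, ∃ f : Fin (c T) → MvPolynomial (Fin (M + 1)) ℂ,
      (∀ k, ∃ e, 1 ≤ e ∧ (f k).IsHomogeneous e) ∧
      ∀ x ∈ interCone I Q T, (∀ k, eval x (f k) = 0) → x = 0 := by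
    intro T
    rw [hcone]
    exact exists_cut (c T) (U T) (hU T) (hdim T).le
  have hsubc : ∀ T' T, T' ⊆ T → c T' ≤ c T + (T \ T').card := by
    intro T' T hT
    obtain ⟨f, hf1, hf2⟩ := hexists T
    have := dim_le_of_cut (U T') (hU T') (ι := Fin (c T) ⊕ {j // j ∈ T \ T'})
      (Sum.elim f (fun j => Q j.1)) (by
        rintro (k | j)
        · exact hf1 k
        · exact ⟨d j.1, hd _, hQ _⟩) (by
        intro x hx hk
        rw [← hcone] at hx
        refine hf2 x ⟨hx.1, ?_⟩ (fun k => hk (Sum.inl k))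
        simp only [Set.mem_iInter]
        intro j hj
        by_cases hj' : j ∈ T'
        · have := hx.2
          simp only [Set.mem_iInter] at this
          exact this j hj'
        · exact hk (Sum.inr ⟨j, Finset.mem_sdiff.mpr ⟨hj, hj'⟩⟩))
    rw [hdim, Fintype.card_sum, Fintype.card_fin, Fintype.card_coe] at this
    exact_mod_cast this
  have hmono : ∀ T' T, T' ⊆ T → c T ≤ c T' := by
    intro T' T hT
    have h1 : Ideal.span (U T') ≤ Ideal.span (U T) :=
      Ideal.span_mono (Set.union_subset_union_right _ (Set.image_mono (by exact_mod_cast hT)))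
    have := ringKrullDim_le_of_surjective (Ideal.Quotient.factor h1)
      (Ideal.Quotient.factor_surjective h1)
    rw [hdim, hdim] at this
    exact_mod_cast this
  have h0 : c ∅ = n + 1 := by
    have h1 : Ideal.span (U ∅) = I := by simp [U, hIS]
    have := hdim ∅
    rw [h1, hIdim] at this
    exact_mod_cast this.symm
  have h1 : ∀ j, c {j} ≤ n := by
    intro j
    have hjI : Q j ∉ I := fun h => hnot j fun x hx => hx _ h
    have := dim_cut I (Ideal.span (U {j}))
      (by rw [hIS]; exact Ideal.span_mono Set.subset_union_left) (Q j)
      (Ideal.subset_span (Or.inr ⟨j, by simp, rfl⟩)) (by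
        intro p hp
        rw [Ideal.minimalPrimes_eq_subsingleton_self] at hp
        rw [Set.mem_singleton_iff] at hp
        left; rwa [hp]) n hIdim.le
    rw [hdim] at this
    exact_mod_cast this
  have hlow : ∀ T, n + 1 ≤ c T + T.card := by
    intro T
    have := hsubc ∅ T (Finset.empty_subset _)
    simpa [h0] using this
  have hgen : ∀ T, c T + T.card = n + 1 → GenPos n I Q T := by
    intro T hT J hJ _ _
    have h2 := hsubc J T hJ
    rw [Finset.card_sdiff_of_subset hJ] at h2
    have h3 := Finset.card_le_card hJ
    have := hlow J
    have h4 : n + 1 - J.card = c J := by omega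
    rw [h4]
    exact hexists J
  have hspan : ∀ T R : Finset (Fin q), T.Nonempty → c T + T.card = n + 1 → T ⊆ R →
      (∀ i ∈ R, i ∉ T → c (insert i T) = c T) → c R = c T := by
    intro T R hTne hT hTR hmax
    refine le_antisymm (hmono T R hTR) ?_
    by_cases hx : ∃ x ∈ interCone I Q T, x ≠ 0
    · obtain ⟨σ, hσ1, hσ2, hσ3⟩ := hII T hTne.card_pos (by omega) (hgen T hT) hx
      have hsubset : σ ⊆ interCone I Q R := by
        intro x hxσ
        have hxT := hσ1.1 hxσ
        refine ⟨hxT.1, ?_⟩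
        simp only [Set.mem_iInter]
        intro j hj
        by_cases hjT : j ∈ T
        · have := hxT.2
          simp only [Set.mem_iInter] at this
          exact this j hjT
        · exact hσ3 j hjT (hmax j hj hjT) hxσ
      have hσcone : σ = coneOf (vIdeal σ) := hσ1.2.1
      have hle : Ideal.span (U R) ≤ vIdeal σ := by
        intro P hP x hxσ
        have := hsubset hxσ
        rw [hcone] at this
        exact this P hP
      have := ringKrullDim_le_of_surjective (Ideal.Quotient.factor hle)
        (Ideal.Quotient.factor_surjective hle)
      rw [hdim, coneDim_eq _ hσ1.2.2.1.ne_top, ← hσcone, hσ2] at this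
      exact_mod_cast this
    · push Not at hx
      have := dim_le_of_cut (U T) (hU T) (ι := Fin 0) (fun k => 0) (fun k => k.elim0)
        (fun x hxT _ => hx x (by rwa [hcone]))
      rw [hdim, Fintype.card_fin] at this
      have h5 : c T ≤ 0 := by exact_mod_cast this
      omega
  obtain ⟨T, hTR, hgT, hcT, -, hineq⟩ := comb c hsubc hmono h0 h1 hspan ω E R (by
    intro R' hR' hne
    exact hw6 R' hne.card_pos ((Finset.card_le_card hR').trans hR2))
  refine ⟨T, hTR, ?_, hgen T hgT, ?_⟩
  · change T.card = n + 1 - c R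
    omega
  · simpa using hineq 0 (fun j _ => hE j)

end SMT
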